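/- For α ∈ [1/2, 1], there exists a constant C > 1 such that C^{−1} λ(A) ≤ μ_α(A) ≤ C λ(A) for every Borel measurable set A ⊆ [α−1, α); equivalently, the density of μ_α with respect to Lebesgue measure is bounded above and bounded away from zero. -/

import Mathlib

open MeasureTheory Set

noncomputable def g : ℝ := (Real.sqrt 5 - 1) / 2

noncomputable def T (α : ℝ) (x : ℝ) : ℝ :=
  if x = 0 then 0 else 1 / x - ⌊1 / x + 1 - α⌋

noncomputable def digit (α : ℝ) (k : ℕ) (x : ℝ) : ℤ :=
  if (T α)^[k - 1] x = 0 then 0 else ⌊1 / ((T α)^[k - 1] x) + 1 - α⌋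

noncomputable def cylinder (α : ℝ) (n : ℕ) (a : ℕ → ℤ) : Set ℝ :=
  {x | x ∈ Set.Ico (α - 1) α ∧ ∀ k, 1 ≤ k → k ≤ n → digit α k x = a k}

def contQ (a : ℕ → ℤ) : ℕ → ℤ
  | 0 => 1
  | 1 => a 1
  | (n + 2) => a (n + 2) * contQ a (n + 1) + contQ a n

def contP (a : ℕ → ℤ) : ℕ → ℤ
  | 0 => 0
  | 1 => 1
  | (n + 2) => a (n + 2) * contP a (n + 1) + contP a n

noncomputable def NT (α : ℝ) (p : ℝ × ℝ) : ℝ × ℝ :=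
  if p.1 = 0 then (0, 0)
  else (1 / p.1 - ⌊1 / p.1 + 1 - α⌋, 1 / (p.2 + ⌊1 / p.1 + 1 - α⌋))

noncomputable def Omega (α : ℝ) : Set (ℝ × ℝ) :=
  ⋃ n : ℕ, closure ((NT α)^[n] '' (Set.Ico (α - 1) α ×ˢ ({0} : Set ℝ)))

def Sset (x y : ℝ) : Set (ℝ × ℝ) :=
  {(x, y), (-x, -y), (x + 1, y / (1 - y)), (1 - x, -y / (y + 1))}

noncomputable def jumpTime (α : ℝ) (x : ℝ) : ℕ :=
  sInf {n : ℕ | 1 ≤ n ∧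
    (T α)^[n] '' cylinder α n (fun k => digit α k x) = Set.Ico (α - 1) α}

noncomputable def jumpT (α : ℝ) (x : ℝ) : ℝ := (T α)^[jumpTime α x] x

section MeanErgodic
open Filter Topology

theorem Ergodic.exists_ae_tendsto_birkhoffAverage_indicator {X : Type*} [MeasurableSpace X]
    {S : X → X} {μ : Measure X} [IsProbabilityMeasure μ] (hS : Ergodic S μ)
    {A : Set X} (hA : MeasurableSet A) :
    ∃ (c : ℝ) (φ : ℕ → ℕ), StrictMono φ ∧ ∀ᵐ x ∂μ, Tendsto
      (fun n => ((φ n : ℝ))⁻¹ * ∑ k ∈ Finset.range (φ n), (S^[k] ⁻¹' A).indicator 1 x)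
      atTop (𝓝 c) := by
  have hS' : MeasurePreserving S μ μ := hS.toMeasurePreserving
  let U : Lp ℝ 2 μ →L[ℝ] Lp ℝ 2 μ :=
    (Lp.compMeasurePreservingₗᵢ ℝ S hS').toContinuousLinearMap
  have hU : ‖U‖ ≤ 1 := LinearIsometry.norm_toContinuousLinearMap_le _
  let f : Lp ℝ 2 μ := indicatorConstLp 2 hA (measure_ne_top μ A) 1
  have hlim := U.tendsto_birkhoffAverage_orthogonalProjection hU f
  set G : Lp ℝ 2 μ := (((U.eqLocus (1 : Lp ℝ 2 μ →L[ℝ] Lp ℝ 2 μ)).orthogonalProjectionOnto f :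
    U.eqLocus (1 : Lp ℝ 2 μ →L[ℝ] Lp ℝ 2 μ)) : Lp ℝ 2 μ) with hG
  have hfix : U G = G := by
    have := ((U.eqLocus (1 : Lp ℝ 2 μ →L[ℝ] Lp ℝ 2 μ)).orthogonalProjectionOnto f).2
    exact this
  obtain ⟨c, hc⟩ : ∃ c, G =ᵐ[μ] Function.const X c := by
    refine hS.ae_eq_const_of_ae_eq_comp_ae (Lp.aestronglyMeasurable G) ?_
    have h1 := Lp.coeFn_compMeasurePreserving G hS'
    have h2 : Lp.compMeasurePreserving S hS' G = G := hfix
    rw [h2] at h1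
    exact h1.symm
  obtain ⟨φ, hφ, hae⟩ := (tendstoInMeasure_of_tendsto_Lp hlim).exists_seq_tendsto_ae
  refine ⟨c, φ, hφ, ?_⟩
  have hiter : ∀ k, U^[k] f = indicatorConstLp 2 (hA.preimage (hS'.iterate k).measurable)
      (measure_ne_top μ _) (1 : ℝ) := by
    intro k
    have : (U^[k] f) = (Lp.compMeasurePreserving S hS')^[k] f := rfl
    rw [this, Lp.compMeasurePreserving_iterate]
    exact Lp.indicatorConstLp_compMeasurePreserving hA _ _ _
  have hcoe : ∀ n : ℕ, (birkhoffAverage ℝ U id n f : Lp ℝ 2 μ) =ᵐ[μ]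
      fun x => ((n : ℝ))⁻¹ * ∑ k ∈ Finset.range n, (S^[k] ⁻¹' A).indicator 1 x := by
    intro n
    have h0 : birkhoffAverage ℝ U id n f = ((n : ℝ))⁻¹ • ∑ k ∈ Finset.range n, U^[k] f := rfl
    rw [h0]
    have h1 := Lp.coeFn_smul ((n : ℝ))⁻¹ (∑ k ∈ Finset.range n, U^[k] f)
    have h2 := Lp.coeFn_finsetSum (Finset.range n) (fun k => U^[k] f)
    have h3 : ∀ᵐ x ∂μ, ∀ k, (U^[k] f) x = (S^[k] ⁻¹' A).indicator 1 x := by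
      rw [ae_all_iff]
      intro k
      rw [hiter]
      exact indicatorConstLp_coeFn
    filter_upwards [h1, h2, h3] with x h1 h2 h3
    rw [h1, Pi.smul_apply, h2, Finset.sum_apply]
    simp only [h3, smul_eq_mul]
  have hcoe' := ae_all_iff.2 hcoe
  filter_upwards [hae, hcoe', hc] with x hx1 hx2 hx3
  have hx3' : (((U.eqLocus (1 : Lp ℝ 2 μ →L[ℝ] Lp ℝ 2 μ)).orthogonalProjectionOnto f :
    U.eqLocus (1 : Lp ℝ 2 μ →L[ℝ] Lp ℝ 2 μ)) : Lp ℝ 2 μ) x = c := hx3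
  rw [hx3'] at hx1
  refine hx1.congr fun n => ?_
  exact hx2 (φ n)

theorem tendsto_average_measureReal_preimage {X : Type*} [MeasurableSpace X]
    {S : X → X} (hS : Measurable S) {ν : Measure X} [IsProbabilityMeasure ν]
    {A : Set X} (hA : MeasurableSet A) {c : ℝ} {φ : ℕ → ℕ}
    (h : ∀ᵐ x ∂ν, Tendsto
      (fun n => ((φ n : ℝ))⁻¹ * ∑ k ∈ Finset.range (φ n), (S^[k] ⁻¹' A).indicator 1 x)
      atTop (𝓝 c)) :
    Tendsto (fun n => ((φ n : ℝ))⁻¹ * ∑ k ∈ Finset.range (φ n), ν.real (S^[k] ⁻¹' A))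
      atTop (𝓝 c) := by
  have hm : ∀ k, MeasurableSet (S^[k] ⁻¹' A) := fun k => hA.preimage (hS.iterate k)
  have key := tendsto_integral_of_dominated_convergence (μ := ν) (fun _ => (1 : ℝ))
    (F := fun n x => ((φ n : ℝ))⁻¹ * ∑ k ∈ Finset.range (φ n),
      (S^[k] ⁻¹' A).indicator (1 : X → ℝ) x) (f := fun _ => c) ?_ (integrable_const _) ?_ h
  · simp only [integral_const, probReal_univ, smul_eq_mul, one_mul] at key
    refine key.congr fun n => ?_
    rw [integral_const_mul, integral_finsetSum]
    · simp only [integral_indicator_one (hm _)]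
    · intro k _
      exact (integrable_const (1 : ℝ)).indicator (hm k)
  · intro n
    refine (Measurable.const_mul ?_ _).aestronglyMeasurable
    exact Finset.measurable_sum _ fun k _ => measurable_one.indicator (hm k)
  · intro n
    refine Eventually.of_forall fun x => ?_
    have h0 : ∀ k, 0 ≤ (S^[k] ⁻¹' A).indicator (1 : X → ℝ) x :=
      fun k => indicator_nonneg (fun _ _ => zero_le_one) x
    have h1 : ∑ k ∈ Finset.range (φ n), (S^[k] ⁻¹' A).indicator (1 : X → ℝ) x ≤ φ n := by
      calc _ ≤ ∑ k ∈ Finset.range (φ n), (1 : ℝ) :=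
            Finset.sum_le_sum fun k _ => indicator_le_self' (fun _ _ => zero_le_one) x
        _ = φ n := by simp
    rw [Real.norm_of_nonneg (mul_nonneg (by positivity) (Finset.sum_nonneg fun k _ => h0 k))]
    rcases Nat.eq_zero_or_pos (φ n) with h2 | h2
    · simp [h2]
    · rw [inv_mul_le_iff₀ (by positivity), mul_one]
      exact h1

/-- If `ν ≪ μ` and `μ` is an ergodic probability measure, then uniform bounds on the measures
`ν (S^[k] ⁻¹' A)` are inherited by `μ A`. -/
theorem Ergodic.measureReal_mem_Icc {X : Type*} [MeasurableSpace X]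
    {S : X → X} {μ ν : Measure X} [IsProbabilityMeasure μ] [IsProbabilityMeasure ν]
    (hS : Ergodic S μ) (hν : ν ≪ μ) {A : Set X} (hA : MeasurableSet A) {a b : ℝ}
    (h : ∀ k, ν.real (S^[k] ⁻¹' A) ∈ Icc a b) : μ.real A ∈ Icc a b := by
  obtain ⟨c, φ, hφ, hc⟩ := hS.exists_ae_tendsto_birkhoffAverage_indicator hA
  have hmeas : Measurable S := hS.toMeasurePreserving.measurable
  have h1 := tendsto_average_measureReal_preimage hmeas hA hc
  have h2 := tendsto_average_measureReal_preimage hmeas hA (hν.ae_le hc)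
  have hev : ∀ᶠ n in atTop, 0 < φ n :=
    (eventually_ge_atTop 1).mono fun n hn => lt_of_lt_of_le hn (hφ.id_le n)
  have h3 : c = μ.real A := by
    refine tendsto_nhds_unique h1 (tendsto_const_nhds.congr' ?_)
    filter_upwards [hev] with n hn
    have : ∀ k, μ.real (S^[k] ⁻¹' A) = μ.real A := fun k =>
      congrArg ENNReal.toReal
        ((hS.toMeasurePreserving.iterate k).measure_preimage hA.nullMeasurableSet)
    simp only [this, Finset.sum_const, Finset.card_range, nsmul_eq_mul]
    field_simp
  rw [← h3]
  refine isClosed_Icc.mem_of_tendsto h2 ?_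
  filter_upwards [hev] with n hn
  have hn' : (0 : ℝ) < φ n := by exact_mod_cast hn
  constructor
  · rw [le_inv_mul_iff₀ hn']
    calc (φ n : ℝ) * a = ∑ k ∈ Finset.range (φ n), a := by simp
      _ ≤ _ := Finset.sum_le_sum fun k _ => (h k).1
  · rw [inv_mul_le_iff₀ hn']
    calc _ ≤ ∑ k ∈ Finset.range (φ n), b := Finset.sum_le_sum fun k _ => (h k).2
      _ = (φ n : ℝ) * b := by simp

end MeanErgodic

section TransferOperator
open scoped ENNReal

/-- The Perron–Frobenius operator of `T α` with respect to Lebesgue measure on `[α - 1, α)`.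
The function `transferOp α f` is considered on the whole line, where it is `1`-periodic. -/
noncomputable def transferOp (α : ℝ) (f : ℝ → ℝ≥0∞) (y : ℝ) : ℝ≥0∞ :=
  ∑' a : ℤ, ENNReal.ofReal (((y + a) ^ 2)⁻¹) * (Ico (α - 1) α).indicator f (y + a)⁻¹

theorem transferOp_mono {α : ℝ} {f h : ℝ → ℝ≥0∞} (hfh : ∀ x ∈ Ico (α - 1) α, x ≠ 0 → f x ≤ h x) :
    transferOp α f ≤ transferOp α h := by
  intro y
  refine ENNReal.tsum_le_tsum fun a => ?_
  rcases eq_or_ne (y + a) 0 with h0 | h0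
  · simp [h0]
  refine mul_le_mul' le_rfl ?_
  by_cases hx : (y + a)⁻¹ ∈ Ico (α - 1) α
  · rw [indicator_of_mem hx, indicator_of_mem hx]
    exact hfh _ hx (inv_ne_zero h0)
  · rw [indicator_of_notMem hx, indicator_of_notMem hx]

theorem transferOp_monotone (α : ℝ) : Monotone (transferOp α) :=
  fun _ _ h => transferOp_mono fun x _ _ => h x

theorem transferOp_const_mul (α : ℝ) (c : ℝ≥0∞) (f : ℝ → ℝ≥0∞) :
    transferOp α (fun x => c * f x) = fun x => c * transferOp α f x := by
  funext y
  simp only [transferOp]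
  rw [← ENNReal.tsum_mul_left]
  refine tsum_congr fun a => ?_
  rw [indicator_const_mul]
  ring

theorem measurable_transferOp {α : ℝ} {f : ℝ → ℝ≥0∞} (hf : Measurable f) :
    Measurable (transferOp α f) := by
  refine Measurable.tsum fun a => ?_
  have h1 : Measurable fun y : ℝ => (Ico (α - 1) α).indicator f (y + a)⁻¹ :=
    (hf.indicator measurableSet_Ico).comp (by fun_prop)
  exact (ENNReal.measurable_ofReal.comp (by fun_prop)).mul h1

theorem transferOp_periodic (α : ℝ) (f : ℝ → ℝ≥0∞) :
    Function.Periodic (transferOp α f) 1 := by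
  intro y
  simp only [transferOp]
  rw [← (Equiv.addRight (1 : ℤ)).tsum_eq
    (fun a : ℤ => ENNReal.ofReal (((y + a) ^ 2)⁻¹) * (Ico (α - 1) α).indicator f (y + a)⁻¹)]
  refine tsum_congr fun a => ?_
  simp only [Equiv.coe_addRight, Int.cast_add, Int.cast_one]
  ring_nf

theorem le_transferOp {α : ℝ} {f : ℝ → ℝ≥0∞} {w : ℝ} (hw : w⁻¹ ∈ Ico (α - 1) α) :
    ENNReal.ofReal ((w ^ 2)⁻¹) * f w⁻¹ ≤ transferOp α f w := by
  have := ENNReal.le_tsum (f := fun a : ℤ =>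
    ENNReal.ofReal (((w + a) ^ 2)⁻¹) * (Ico (α - 1) α).indicator f (w + a)⁻¹) 0
  simpa [hw, transferOp] using this

theorem measurable_T (α : ℝ) : Measurable (T α) := by
  unfold T
  refine Measurable.ite (measurableSet_singleton 0) measurable_const ?_
  have h : Measurable fun x : ℝ => ⌊1 / x + 1 - α⌋ := Int.measurable_floor.comp (by fun_prop)
  have h' : Measurable fun x : ℝ => ((⌊1 / x + 1 - α⌋ : ℤ) : ℝ) :=
    (measurable_of_countable _).comp h
  exact (by fun_prop : Measurable fun x : ℝ => 1 / x).sub h'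

theorem T_eq_iff {α x y : ℝ} (hx : x ≠ 0) (hy : y ∈ Ico (α - 1) α) :
    T α x = y ↔ ∃ a : ℤ, x⁻¹ = y + a := by
  simp only [T, if_neg hx, one_div]
  constructor
  · intro h
    exact ⟨⌊x⁻¹ + 1 - α⌋, by linarith⟩
  · rintro ⟨a, ha⟩
    have : ⌊x⁻¹ + 1 - α⌋ = a := by
      rw [Int.floor_eq_iff, ha]
      constructor <;> linarith [hy.1, hy.2]
    rw [this, ha]
    ring

theorem lintegral_transferOp {α : ℝ} {f : ℝ → ℝ≥0∞} (hf : Measurable f) {A : Set ℝ}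
    (hA : MeasurableSet A) (hAI : A ⊆ Ico (α - 1) α) :
    ∫⁻ y in A, transferOp α f y = ∫⁻ x in T α ⁻¹' A ∩ Ico (α - 1) α, f x := by
  set F := (Ico (α - 1) α).indicator f with hF
  have hFm : Measurable F := hf.indicator measurableSet_Ico
  have hinj : ∀ a : ℤ, InjOn (fun y : ℝ => (y + a)⁻¹) (A \ {-(a : ℝ)}) := by
    intro a y _ z _ h
    have := inv_injective h
    linarith
  have hSm : ∀ a : ℤ, MeasurableSet (A \ {-(a : ℝ)}) :=
    fun a => hA.diff (measurableSet_singleton _)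
  have himg : ∀ a : ℤ, (fun y : ℝ => (y + a)⁻¹) '' (A \ {-(a : ℝ)}) =
      {x : ℝ | x ≠ 0 ∧ x⁻¹ - a ∈ A} := by
    intro a
    ext x
    constructor
    · rintro ⟨y, ⟨hy, hya⟩, rfl⟩
      have hne : y + a ≠ 0 := fun h => hya (by rw [mem_singleton_iff]; linarith)
      exact ⟨inv_ne_zero hne, by simpa using hy⟩
    · rintro ⟨hx, hxA⟩
      refine ⟨x⁻¹ - a, ⟨hxA, fun h => ?_⟩, by simp⟩
      rw [mem_singleton_iff] at h
      exact inv_ne_zero hx (by linarith)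
  have hterm : ∀ a : ℤ, ∫⁻ y in A, ENNReal.ofReal (((y + a) ^ 2)⁻¹) * F (y + a)⁻¹ =
      ∫⁻ x in {x : ℝ | x ≠ 0 ∧ x⁻¹ - a ∈ A}, F x := by
    intro a
    rw [← himg a, lintegral_image_eq_lintegral_abs_deriv_mul (hSm a)
      (f' := fun y => -1 / (y + a) ^ 2) ?_ (hinj a)]
    · rw [Measure.restrict_congr_set (sdiff_null_ae_eq_self (s := A) (measure_singleton (-(a : ℝ))))]
      refine lintegral_congr fun y => ?_
      rw [abs_div, abs_neg, abs_one, abs_of_nonneg (sq_nonneg _), one_div]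
    · intro y hy
      have hne : y + a ≠ 0 := fun h => hy.2 (by rw [mem_singleton_iff]; linarith)
      exact (((hasDerivAt_id y).add_const (a : ℝ)).inv hne).hasDerivWithinAt
  have hmeas : ∀ a : ℤ, MeasurableSet {x : ℝ | x ≠ 0 ∧ x⁻¹ - a ∈ A} := by
    intro a
    exact (measurableSet_singleton (0 : ℝ)).compl.inter
      (hA.preimage (by fun_prop : Measurable fun x : ℝ => x⁻¹ - a))
  have hunion : (⋃ a : ℤ, {x : ℝ | x ≠ 0 ∧ x⁻¹ - a ∈ A}) = T α ⁻¹' A \ {0} := by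
    ext x
    simp only [mem_iUnion, mem_ofPred_eq, mem_sdiff, mem_preimage, mem_singleton_iff]
    constructor
    · rintro ⟨a, hx, hxA⟩
      have : T α x = x⁻¹ - a := (T_eq_iff hx (hAI hxA)).2 ⟨a, by ring⟩
      exact ⟨this ▸ hxA, hx⟩
    · rintro ⟨hxA, hx⟩
      obtain ⟨a, ha⟩ := (T_eq_iff hx (hAI hxA)).1 rfl
      exact ⟨a, hx, by rwa [ha, add_sub_cancel_right]⟩
  have hdisj : Pairwise (Function.onFun Disjoint fun a : ℤ => {x : ℝ | x ≠ 0 ∧ x⁻¹ - a ∈ A}) := by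
    intro a b hab
    rw [Function.onFun, Set.disjoint_left]
    rintro x ⟨-, hxa⟩ ⟨-, hxb⟩
    have h1 := hAI hxa
    have h2 := hAI hxb
    apply hab
    have h3 : ((a - b : ℤ) : ℝ) < 1 := by push_cast; linarith [h1.1, h2.2]
    have h4 : (-1 : ℝ) < ((a - b : ℤ) : ℝ) := by push_cast; linarith [h1.2, h2.1]
    have h5 : a - b < 1 := by exact_mod_cast h3
    have h6 : -1 < a - b := by exact_mod_cast h4
    omega
  have hFm' : ∀ a : ℤ, Measurable fun y : ℝ =>
      ENNReal.ofReal (((y + a) ^ 2)⁻¹) * F (y + a)⁻¹ := fun a =>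
    (ENNReal.measurable_ofReal.comp (by fun_prop)).mul (hFm.comp (by fun_prop))
  unfold transferOp
  rw [lintegral_tsum fun a => (hFm' a).aemeasurable]
  simp only [hterm]
  rw [← lintegral_iUnion hmeas hdisj, hunion,
    Measure.restrict_congr_set (sdiff_null_ae_eq_self (measure_singleton _)), hF,
    lintegral_indicator measurableSet_Ico, Measure.restrict_restrict measurableSet_Ico, inter_comm]

theorem T_mem {α : ℝ} (hα : 0 < α) (hα' : α ≤ 1) (x : ℝ) : T α x ∈ Ico (α - 1) α := by
  unfold T
  split_ifs with hx
  · constructor <;> linarith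
  · have h1 := Int.floor_le (1 / x + 1 - α)
    have h2 := Int.lt_floor_add_one (1 / x + 1 - α)
    constructor <;> linarith

theorem lintegral_transferOp_iterate {α : ℝ} (hα : 0 < α) (hα' : α ≤ 1) {f : ℝ → ℝ≥0∞}
    (hf : Measurable f) (n : ℕ) {A : Set ℝ} (hA : MeasurableSet A) (hAI : A ⊆ Ico (α - 1) α) :
    ∫⁻ y in A, (transferOp α)^[n] f y = ∫⁻ x in (T α)^[n] ⁻¹' A ∩ Ico (α - 1) α, f x := by
  induction n generalizing f with
  | zero => simp [inter_eq_left.2 hAI]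
  | succ n ih =>
    have hm : MeasurableSet ((T α)^[n] ⁻¹' A ∩ Ico (α - 1) α) :=
      (hA.preimage ((measurable_T α).iterate n)).inter measurableSet_Ico
    rw [Function.iterate_succ_apply, ih (measurable_transferOp hf),
      lintegral_transferOp hf hm inter_subset_right, Function.iterate_succ, preimage_comp,
      preimage_inter, (eq_univ_of_forall (T_mem hα hα') : T α ⁻¹' Ico (α - 1) α = univ),
      inter_univ]

end TransferOperator

section Comparison
open scoped ENNReal

theorem exists_bound_of_transferOp_iterate_bound {α : ℝ} (hα : 0 < α) (hα' : α ≤ 1)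
    {μ : Measure ℝ} [IsProbabilityMeasure μ] (herg : Ergodic (T α) μ)
    (hca : volume.restrict (Ico (α - 1) α) ≪ μ) {c C : ℝ} (hc : 0 < c)
    (h : ∀ n, ∀ y ∈ Ico (α - 1) α, y ≠ 0 →
      (transferOp α)^[n] (fun _ => 1) y ∈ Icc (ENNReal.ofReal c) (ENNReal.ofReal C)) :
    ∃ K : ℝ≥0∞, 1 < K ∧ K ≠ ⊤ ∧
      ∀ A : Set ℝ, MeasurableSet A → A ⊆ Ico (α - 1) α →
        K⁻¹ * volume A ≤ μ A ∧ μ A ≤ K * volume A := by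
  set ν := volume.restrict (Ico (α - 1) α) with hν
  have : IsProbabilityMeasure ν := ⟨by simp [hν]⟩
  have key : ∀ A : Set ℝ, MeasurableSet A → A ⊆ Ico (α - 1) α →
      ENNReal.ofReal c * volume A ≤ μ A ∧ μ A ≤ ENNReal.ofReal C * volume A := by
    intro A hA hAI
    have hfin : volume A ≠ ⊤ := ne_top_of_le_ne_top (by simp) (measure_mono hAI)
    have hk : ∀ n, ν.real ((T α)^[n] ⁻¹' A) ∈
        Icc ((ENNReal.ofReal c * volume A).toReal) ((ENNReal.ofReal C * volume A).toReal) := by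
      intro n
      have h1 := lintegral_transferOp_iterate hα hα' (measurable_const (a := (1 : ℝ≥0∞))) n hA hAI
      rw [setLIntegral_const, one_mul, ← Measure.restrict_apply
        (hA.preimage ((measurable_T α).iterate n)), ← hν] at h1
      have hae : ∀ᵐ y ∂volume.restrict A, y ∈ Ico (α - 1) α ∧ y ≠ 0 := by
        filter_upwards [ae_restrict_mem hA, ae_restrict_of_ae (Measure.ae_ne volume (0 : ℝ))]
          with y hy hy'
        exact ⟨hAI hy, hy'⟩
      constructor
      · refine ENNReal.toReal_mono (measure_ne_top _ _) ?_
        rw [← h1, ← setLIntegral_const]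
        refine lintegral_mono_ae ?_
        filter_upwards [hae] with y hy
        exact (h n y hy.1 hy.2).1
      · refine ENNReal.toReal_mono (ENNReal.mul_ne_top ENNReal.ofReal_ne_top hfin) ?_
        rw [← h1, ← setLIntegral_const]
        refine lintegral_mono_ae ?_
        filter_upwards [hae] with y hy
        exact (h n y hy.1 hy.2).2
    have h2 := herg.measureReal_mem_Icc hca hA hk
    constructor
    · exact (ENNReal.toReal_le_toReal (ENNReal.mul_ne_top ENNReal.ofReal_ne_top hfin)
        (measure_ne_top _ _)).1 h2.1
    · exact (ENNReal.toReal_le_toReal (measure_ne_top _ _)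
        (ENNReal.mul_ne_top ENNReal.ofReal_ne_top hfin)).1 h2.2
  refine ⟨max 2 (max (ENNReal.ofReal c)⁻¹ (ENNReal.ofReal C)), ?_, ?_, fun A hA hAI => ?_⟩
  · exact lt_of_lt_of_le (by norm_num) (le_max_left _ _)
  · have : (ENNReal.ofReal c)⁻¹ ≠ ⊤ := by simpa using hc
    simp [this]
  · obtain ⟨h1, h2⟩ := key A hA hAI
    constructor
    · refine le_trans (mul_le_mul' ?_ le_rfl) h1
      rw [ENNReal.inv_le_iff_inv_le]
      exact (le_max_left _ _).trans (le_max_right _ _)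
    · exact h2.trans (mul_le_mul' ((le_max_right _ _).trans (le_max_right _ _)) le_rfl)

end Comparison

section Gauss
open scoped ENNReal Topology
open Filter

theorem hasSum_one_div_mul_succ {y : ℝ} (hy : 0 < y) :
    HasSum (fun n : ℕ => 1 / ((y + n) * (y + n + 1))) (1 / y) := by
  rw [hasSum_iff_tendsto_nat_of_nonneg fun n => by positivity]
  have hsum : ∀ n : ℕ, ∑ i ∈ Finset.range n, 1 / ((y + i) * (y + i + 1)) =
      1 / y - 1 / (y + n) := by
    intro n
    induction n with
    | zero => simp
    | succ n ih =>
      rw [Finset.sum_range_succ, ih]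
      push_cast
      have : y + n ≠ 0 := by positivity
      have : y + n + 1 ≠ 0 := by positivity
      have : y + (n + 1) ≠ 0 := by positivity
      field_simp
      ring
  simp only [hsum]
  have h1 : Tendsto (fun n : ℕ => y + (n : ℝ)) atTop atTop :=
    tendsto_atTop_add_const_left _ _ tendsto_natCast_atTop_atTop
  simpa using (h1.inv_tendsto_atTop.const_sub (1 / y))

theorem transferOp_one_gauss {y : ℝ} (hy : y ∈ Ioo (0 : ℝ) 1) :
    transferOp 1 (fun x => ENNReal.ofReal (1 / (1 + x))) y = ENNReal.ofReal (1 / (1 + y)) := by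
  unfold transferOp
  have hinj : Function.Injective fun n : ℕ => ((n : ℤ) + 1) := by
    intro a b h
    simpa using h
  rw [← hinj.tsum_eq, ← (hasSum_one_div_mul_succ (y := 1 + y) (by linarith [hy.1])).tsum_eq,
    ENNReal.ofReal_tsum_of_nonneg (fun n => by have := hy.1; positivity)
      (hasSum_one_div_mul_succ (y := 1 + y) (by linarith [hy.1])).summable]
  · refine tsum_congr fun n => ?_
    have h0 := hy.1
    have hpos : (0 : ℝ) < y + ((n : ℝ) + 1) := by positivity
    have hmem : (y + (((n : ℤ) + 1 : ℤ) : ℝ))⁻¹ ∈ Ico ((1 : ℝ) - 1) 1 := by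
      push_cast
      refine ⟨by rw [sub_self]; positivity, inv_lt_one_of_one_lt₀ ?_⟩
      have : (0 : ℝ) ≤ n := by positivity
      linarith
    rw [indicator_of_mem hmem, ← ENNReal.ofReal_mul (by positivity)]
    congr 1
    push_cast
    have : 1 + y + (n : ℝ) ≠ 0 := by positivity
    have : 1 + y + (n : ℝ) + 1 ≠ 0 := by positivity
    field_simp
    ring
  · intro a ha
    by_contra hcon
    have ha' : a ≤ 0 := by
      by_contra! h
      exact hcon ⟨(a - 1).toNat, by simp; omega⟩
    apply ha
    have ha'' : (a : ℝ) ≤ 0 := by exact_mod_cast ha'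
    have : (y + a)⁻¹ ∉ Ico ((1 : ℝ) - 1) 1 := by
      rintro ⟨h1, h2⟩
      rw [sub_self, inv_nonneg] at h1
      rcases h1.eq_or_lt with h1 | h1
      · have h3 : (-1 : ℝ) < a := by linarith [hy.2]
        have h4 : (a : ℝ) < 0 := by linarith [hy.1]
        have h5 : -1 < a := by exact_mod_cast h3
        have h6 : a < 0 := by exact_mod_cast h4
        omega
      · rw [inv_lt_one₀ h1] at h2
        linarith [hy.2]
    simp only [indicator_of_notMem this, mul_zero]

theorem transferOp_one_iterate_mem_Icc (n : ℕ) {y : ℝ} (hy : y ∈ Ioo (0 : ℝ) 1) :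
    (transferOp 1)^[n] (fun _ => 1) y ∈ Icc (ENNReal.ofReal (1 / 2)) (ENNReal.ofReal 2) := by
  have hmem : ∀ x ∈ Ico ((1 : ℝ) - 1) 1, x ≠ 0 → x ∈ Ioo (0 : ℝ) 1 := fun x hx h0 =>
    ⟨lt_of_le_of_ne (by simpa using hx.1) h0.symm, hx.2⟩
  have key : ∀ y ∈ Ioo (0 : ℝ) 1,
      ENNReal.ofReal (1 / (1 + y)) ≤ (transferOp 1)^[n] (fun _ => 1) y ∧
      (transferOp 1)^[n] (fun _ => 1) y ≤ 2 * ENNReal.ofReal (1 / (1 + y)) := by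
    induction n with
    | zero =>
      intro y hy
      have h0 := hy.1
      have h1 := hy.2
      refine ⟨?_, ?_⟩
      · rw [Function.iterate_zero, id, ENNReal.ofReal_le_one, div_le_one (by linarith)]
        linarith
      · rw [Function.iterate_zero, id, ← ENNReal.ofReal_ofNat, ← ENNReal.ofReal_mul (by norm_num),
          ENNReal.one_le_ofReal, mul_one_div, le_div_iff₀ (by linarith)]
        linarith
    | succ n ih =>
      intro y hy
      rw [Function.iterate_succ_apply']
      constructor
      · rw [← transferOp_one_gauss hy]
        exact transferOp_mono (fun x hx h0 => (ih x (hmem x hx h0)).1) y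
      · rw [← transferOp_one_gauss hy,
          ← congrFun (transferOp_const_mul 1 2 fun x => ENNReal.ofReal (1 / (1 + x))) y]
        exact transferOp_mono (fun x hx h0 => (ih x (hmem x hx h0)).2) y
  obtain ⟨h1, h2⟩ := key y hy
  have h0 := hy.1
  have h3 := hy.2
  constructor
  · refine le_trans (ENNReal.ofReal_le_ofReal ?_) h1
    exact one_div_le_one_div_of_le (by linarith) (by linarith)
  · refine h2.trans ?_
    rw [← ENNReal.ofReal_ofNat, ← ENNReal.ofReal_mul (by norm_num)]
    refine ENNReal.ofReal_le_ofReal ?_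
    rw [mul_one_div, div_le_iff₀ (by linarith)]
    linarith

end Gauss

section Exactness
open scoped ENNReal

/-- Some iterate of the transfer operator spreads any lower bound on the interval `(u, v)` over
the whole line, up to a constant factor. -/
def Spreads (α u v : ℝ) : Prop :=
  ∃ k : ℕ, ∃ c : ℝ≥0∞, c ≠ 0 ∧ ∀ f : ℝ → ℝ≥0∞, Function.Periodic f 1 →
    ∀ b, (∀ x ∈ Ioo u v, b ≤ f x) → ∀ y, c * b ≤ (transferOp α)^[k] f y

theorem spreads_of_one_lt (α : ℝ) {u v : ℝ} (h : 1 < v - u) : Spreads α u v := by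
  refine ⟨0, 1, one_ne_zero, fun f hf b hb y => ?_⟩
  obtain ⟨m, hm, -⟩ := existsUnique_add_zsmul_mem_Ioc one_pos y u
  rw [one_mul, Function.iterate_zero, id, ← hf.zsmul m y]
  exact hb _ ⟨hm.1, by linarith [hm.2]⟩

theorem Spreads.mono {α u v u' v' : ℝ} (h : Spreads α u' v') (hu : u ≤ u') (hv : v' ≤ v) :
    Spreads α u v := by
  obtain ⟨k, c, hc, H⟩ := h
  exact ⟨k, c, hc, fun f hf b hb => H f hf b fun x hx => hb x (Ioo_subset_Ioo hu hv hx)⟩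

theorem Spreads.of_add_int {α u v : ℝ} (m : ℤ) (h : Spreads α (u + m) (v + m)) :
    Spreads α u v := by
  obtain ⟨k, c, hc, H⟩ := h
  refine ⟨k, c, hc, fun f hf b hb => H f hf b fun x hx => ?_⟩
  have := hf.int_mul m (x - m)
  rw [mul_one, sub_add_cancel] at this
  rw [this]
  exact hb _ ⟨by linarith [hx.1], by linarith [hx.2]⟩

theorem Spreads.of_inv {α u v a b : ℝ} (h : Spreads α a b)
    (hw : ∀ w ∈ Ioo a b, w ≠ 0 ∧ w⁻¹ ∈ Ioo u v ∧ w⁻¹ ∈ Ico (α - 1) α) : Spreads α u v := by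
  obtain ⟨k, c, hc, H⟩ := h
  have hpos : 0 < (a ^ 2 + b ^ 2 + 1)⁻¹ := by positivity
  refine ⟨k + 1, c * ENNReal.ofReal (a ^ 2 + b ^ 2 + 1)⁻¹,
    mul_ne_zero hc (ENNReal.ofReal_pos.2 hpos).ne', fun f hf b' hb' y => ?_⟩
  rw [Function.iterate_succ_apply, mul_assoc]
  refine H _ (transferOp_periodic α f) _ (fun w hwab => ?_) y
  obtain ⟨h0, h1, h2⟩ := hw w hwab
  refine le_trans (mul_le_mul' (ENNReal.ofReal_le_ofReal ?_) (hb' _ h1)) (le_transferOp h2)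
  refine inv_anti₀ (by positivity) ?_
  rcases le_total 0 w with hw0 | hw0
  · nlinarith [hwab.2, sq_nonneg a]
  · nlinarith [hwab.1, sq_nonneg b]

theorem spreads_zero_right {α v : ℝ} (hα : 0 < α) (hα' : α < 1) (hv : 0 < v) :
    Spreads α 0 v := by
  have hm : 0 < min v α := lt_min hv hα
  refine Spreads.of_inv (spreads_of_one_lt α
    (by linarith : 1 < ((min v α)⁻¹ + 2) - (min v α)⁻¹)) fun w hw => ?_
  have hw0 : 0 < w := (inv_pos.2 hm).trans hw.1
  have h1 : w⁻¹ < min v α := inv_lt_of_inv_lt₀ hm hw.1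
  have h2 : 0 < w⁻¹ := inv_pos.2 hw0
  exact ⟨hw0.ne', ⟨h2, h1.trans_le (min_le_left _ _)⟩, by linarith, h1.trans_le (min_le_right _ _)⟩

theorem inv_mem_Ioo_of_neg {u v w : ℝ} (hv : v < 0) (h : w ∈ Ioo v⁻¹ u⁻¹) (hu : u < 0) :
    w < 0 ∧ w⁻¹ ∈ Ioo u v := by
  have hw : w < 0 := h.2.trans (inv_lt_zero.2 hu)
  refine ⟨hw, ?_, ?_⟩
  · have := (inv_lt_inv_of_neg (inv_lt_zero.2 hu) hw).2 h.2
    rwa [inv_inv] at this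
  · have := (inv_lt_inv_of_neg hw (inv_lt_zero.2 hv)).2 h.1
    rwa [inv_inv] at this

theorem spreads_zero_left {α u : ℝ} (hα : 0 < α) (hα' : α < 1) (hu : u < 0) :
    Spreads α u 0 := by
  have hm : max u (α - 1) < 0 := max_lt hu (by linarith)
  refine Spreads.of_inv (spreads_of_one_lt α
    (by linarith : 1 < (max u (α - 1))⁻¹ - ((max u (α - 1))⁻¹ - 2))) fun w hw => ?_
  have hw0 : w < 0 := hw.2.trans (inv_lt_zero.2 hm)
  have h1 : max u (α - 1) < w⁻¹ := by
    have := (inv_lt_inv_of_neg (inv_lt_zero.2 hm) hw0).2 hw.2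
    rwa [inv_inv] at this
  have h2 : w⁻¹ < 0 := inv_lt_zero.2 hw0
  exact ⟨hw0.ne, ⟨(le_max_left _ _).trans_lt h1, h2⟩, ((le_max_right _ _).trans_lt h1).le,
    by linarith⟩

theorem Spreads.of_forall_pos {α ℓ u v : ℝ} (hα : 0 < α) (hℓ : 0 < ℓ)
    (H : ∀ u v, ℓ < v - u → Spreads α u v) (hu : 0 < u) (hv : v ≤ α) (hα' : α < 1)
    (h : ℓ * α ^ 2 < v - u) : Spreads α u v := by
  have huv : u < v := by nlinarith [sq_nonneg α]
  have hv0 : 0 < v := hu.trans huv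
  refine Spreads.of_inv (a := v⁻¹) (b := u⁻¹) (H _ _ ?_) fun w hw => ?_
  · rw [inv_sub_inv hu.ne' hv0.ne', lt_div_iff₀ (by positivity)]
    refine lt_of_le_of_lt (mul_le_mul_of_nonneg_left ?_ hℓ.le) h
    nlinarith
  · have hw0 : 0 < w := (inv_pos.2 hv0).trans hw.1
    have h1 : u < w⁻¹ := lt_inv_of_lt_inv₀ hw0 hw.2
    have h2 : w⁻¹ < v := inv_lt_of_inv_lt₀ hv0 hw.1
    exact ⟨hw0.ne', ⟨h1, h2⟩, by linarith, h2.trans_le hv⟩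

theorem Spreads.of_forall_neg {α ℓ u v : ℝ} (hα : 0 < α) (hα' : α < 1) (hℓ : 0 < ℓ)
    (H : ∀ u v, ℓ < v - u → Spreads α u v) (hu : α - 1 ≤ u) (hu0 : u < 0)
    (h : ℓ * (1 - α) ^ 2 < v - u) : Spreads α u v := by
  rcases le_or_gt 0 v with hv | hv
  · exact (spreads_zero_left hα hα' hu0).mono le_rfl hv
  have huv : u < v := by nlinarith [sq_nonneg (1 - α)]
  have hpos : 0 < u * v := mul_pos_of_neg_of_neg hu0 hv
  refine Spreads.of_inv (a := v⁻¹) (b := u⁻¹) (H _ _ ?_) fun w hw => ?_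
  · rw [inv_sub_inv hu0.ne hv.ne, lt_div_iff₀ hpos]
    refine lt_of_le_of_lt (mul_le_mul_of_nonneg_left ?_ hℓ.le) h
    nlinarith
  · obtain ⟨hw0, hwm⟩ := inv_mem_Ioo_of_neg hv hw hu0
    exact ⟨hw0.ne, hwm, by linarith [hwm.1], by linarith [hwm.2]⟩

theorem spreads_of_pow_lt {α : ℝ} (hα : 0 < α) (hα' : α < 1) (n : ℕ) :
    ∀ u v : ℝ, (α ^ 2 + (1 - α) ^ 2) ^ n < v - u → Spreads α u v := by
  induction n with
  | zero => exact fun u v h => spreads_of_one_lt α (by simpa using h)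
  | succ n ih =>
    set ℓ := (α ^ 2 + (1 - α) ^ 2) ^ n with hℓ
    have hℓ0 : 0 < ℓ := by positivity
    intro u v h
    rw [pow_succ, ← hℓ] at h
    obtain ⟨m, ⟨hm1, hm2⟩, -⟩ := existsUnique_add_zsmul_mem_Ico one_pos u (α - 1)
    rw [zsmul_eq_mul, mul_one] at hm1 hm2
    rw [sub_add_cancel] at hm2
    refine Spreads.of_add_int m ?_
    replace h : ℓ * (α ^ 2 + (1 - α) ^ 2) < (v + m) - (u + m) := by linarith
    generalize u + (m : ℝ) = u at *
    generalize v + (m : ℝ) = v at *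
    have h1 : 0 ≤ ℓ * α ^ 2 := by positivity
    have h2 : 0 ≤ ℓ * (1 - α) ^ 2 := by positivity
    have huv : u < v := by nlinarith
    rcases lt_or_ge u 0 with hu | hu
    · exact Spreads.of_forall_neg hα hα' hℓ0 ih hm1 hu (by nlinarith)
    rcases hu.eq_or_lt with rfl | hu
    · exact spreads_zero_right hα hα' huv
    rcases le_or_gt v α with hv | hv
    · exact Spreads.of_forall_pos hα hℓ0 ih hu hv hα' (by nlinarith)
    by_cases hp : ℓ * α ^ 2 < α - u
    · exact (Spreads.of_forall_pos hα hℓ0 ih hu le_rfl hα' hp).mono le_rfl hv.le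
    · refine Spreads.of_add_int (-1) ?_
      push_cast
      refine Spreads.mono (u' := α - 1) (v' := v + -1) ?_ (by linarith) le_rfl
      exact Spreads.of_forall_neg hα hα' hℓ0 ih le_rfl (by linarith) (by nlinarith)

theorem spreads_of_lt {α : ℝ} (hα : 0 < α) (hα' : α < 1) {u v : ℝ} (h : u < v) :
    Spreads α u v := by
  obtain ⟨n, hn⟩ := exists_pow_lt_of_lt_one (sub_pos.2 h)
    (by nlinarith : α ^ 2 + (1 - α) ^ 2 < 1)
  exact spreads_of_pow_lt hα hα' n u v hn

end Exactness

section Variation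
open scoped ENNReal

theorem eVariationOn_le_add {α E E₁ E₂ : Type*} [LinearOrder α] [PseudoEMetricSpace E]
    [PseudoEMetricSpace E₁] [PseudoEMetricSpace E₂] {f : α → E} {g : α → E₁} {h : α → E₂}
    {s : Set α}
    (H : ∀ x ∈ s, ∀ y ∈ s, edist (f x) (f y) ≤ edist (g x) (g y) + edist (h x) (h y)) :
    eVariationOn f s ≤ eVariationOn g s + eVariationOn h s := by
  refine iSup_le fun ⟨n, u, hu, us⟩ => ?_
  refine (Finset.sum_le_sum fun i _ => H _ (us (i + 1)) _ (us i)).trans ?_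
  rw [Finset.sum_add_distrib]
  exact add_le_add (eVariationOn.sum_le hu us) (eVariationOn.sum_le hu us)

theorem Monotone.eVariationOn_le_ofReal {α : Type*} [LinearOrder α] {f : α → ℝ} (hf : Monotone f)
    {A : ℝ} (h0 : ∀ x, 0 ≤ f x) (hA : ∀ x, f x ≤ A) (s : Set α) :
    eVariationOn f s ≤ ENNReal.ofReal A := by
  refine iSup_le fun ⟨n, u, hu, us⟩ => ?_
  have h : ∀ i ∈ Finset.range n, edist (f (u (i + 1))) (f (u i)) =
      ENNReal.ofReal (f (u (i + 1)) - f (u i)) := fun i _ => by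
    rw [edist_dist, Real.dist_eq, abs_of_nonneg (sub_nonneg.2 (hf (hu i.le_succ)))]
  rw [Finset.sum_congr rfl h, ← ENNReal.ofReal_sum_of_nonneg fun i _ =>
    sub_nonneg.2 (hf (hu i.le_succ)), Finset.sum_range_sub fun i => f (u i)]
  exact ENNReal.ofReal_le_ofReal (by linarith [hA (u n), h0 (u 0)])

theorem edist_toReal_le {a b e : ℝ≥0∞} (ha : a ≠ ⊤) (hb : b ≠ ⊤) (hab : a ≤ b + e)
    (hba : b ≤ a + e) : edist a.toReal b.toReal ≤ e := by
  rcases eq_or_ne e ⊤ with rfl | he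
  · exact le_top
  lift a to NNReal using ha
  lift b to NNReal using hb
  lift e to NNReal using he
  have h1 : (a : ℝ) ≤ b + e := by exact_mod_cast hab
  have h2 : (b : ℝ) ≤ a + e := by exact_mod_cast hba
  rw [edist_dist, Real.dist_eq]
  refine ENNReal.ofReal_le_of_le_toReal ?_
  simp only [ENNReal.coe_toReal]
  rw [abs_le]
  constructor <;> linarith

theorem ofReal_le_ofReal_add_edist (x y : ℝ) :
    ENNReal.ofReal x ≤ ENNReal.ofReal y + edist x y := by
  rw [edist_dist, Real.dist_eq]
  refine le_trans (ENNReal.ofReal_le_ofReal ?_) ENNReal.ofReal_add_le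
  linarith [le_abs_self (x - y)]

theorem eVariationOn_tsum_le {ι α : Type*} [LinearOrder α] (g : ι → α → ℝ) {s : Set α}
    (hs : ∀ x ∈ s, ∑' a, ENNReal.ofReal (g a x) ≠ ⊤) :
    eVariationOn (fun x => (∑' a, ENNReal.ofReal (g a x)).toReal) s ≤
      ∑' a, eVariationOn (g a) s := by
  refine iSup_le fun ⟨n, u, hu, us⟩ => ?_
  have h : ∀ x ∈ s, ∀ y ∈ s, edist (∑' a, ENNReal.ofReal (g a x)).toReal
      (∑' a, ENNReal.ofReal (g a y)).toReal ≤ ∑' a, edist (g a x) (g a y) := by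
    intro x hx y hy
    refine edist_toReal_le (hs x hx) (hs y hy) ?_ ?_ <;> rw [← ENNReal.tsum_add]
    · exact ENNReal.tsum_le_tsum fun a => ofReal_le_ofReal_add_edist _ _
    · refine ENNReal.tsum_le_tsum fun a => ?_
      rw [edist_comm]
      exact ofReal_le_ofReal_add_edist _ _
  refine (Finset.sum_le_sum fun i _ => h _ (us (i + 1)) _ (us i)).trans ?_
  rw [← Summable.tsum_finsetSum fun _ _ => ENNReal.summable]
  exact ENNReal.tsum_le_tsum fun a => eVariationOn.sum_le hu us

theorem tsum_eVariationOn_Icc_int_le {E : Type*} [PseudoEMetricSpace E] (G : ℝ → E) (c : ℝ) :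
    ∑' a : ℤ, eVariationOn G (Icc (c + a) (c + a + 1)) ≤ eVariationOn G univ := by
  rw [ENNReal.tsum_eq_iSup_sum]
  refine iSup_le fun t => ?_
  obtain ⟨N, hN⟩ : ∃ N : ℕ, ∀ a ∈ t, a.natAbs < N :=
    ⟨t.sup Int.natAbs + 1, fun a ha => Nat.lt_succ_of_le (Finset.le_sup ha)⟩
  have hsub : t ⊆ (Finset.range (2 * N)).image fun i : ℕ => (i : ℤ) - N := by
    intro a ha
    have := hN a ha
    rw [Finset.mem_image]
    exact ⟨(a + N).toNat, by rw [Finset.mem_range]; omega, by omega⟩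
  refine (Finset.sum_le_sum_of_subset hsub).trans ?_
  rw [Finset.sum_image fun i _ j _ h => by simpa using h]
  have hmono : Monotone fun i : ℕ => c + i - N := fun i j h => by
    have : (i : ℝ) ≤ j := by exact_mod_cast h
    simp only
    linarith
  have := eVariationOn.sum' G hmono (n := 2 * N)
  refine le_trans (le_of_eq ?_) (this.le.trans (eVariationOn.mono G (subset_univ _)))
  refine Finset.sum_congr rfl fun i _ => ?_
  congr 2 <;> push_cast <;> ring

theorem abs_mul_sub_mul_le {A B a b R v ι : ℝ} (hA : 0 ≤ A) (hB : 0 ≤ B) (ha : 0 ≤ a) (hb : 0 ≤ b)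
    (hR : 0 ≤ R) (hAR : A ≠ 0 → a ≤ R) (hBR : B ≠ 0 → b ≤ R) (hv : |A - B| ≤ v)
    (hι : 0 ≤ ι) (hι' : (A + B - v) / 2 ≤ ι) : |a * A - b * B| ≤ R * v + ι * |a - b| := by
  wlog hab : a ≤ b generalizing a b A B
  · rw [abs_sub_comm, abs_sub_comm a]
    exact this hB hA hb ha hBR hAR (by rwa [abs_sub_comm]) (by linarith) (le_of_not_ge hab)
  rw [abs_sub_comm a, abs_of_nonneg (sub_nonneg.2 hab)]
  have hv0 : 0 ≤ v := (abs_nonneg _).trans hv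
  have h1 : 0 ≤ R * v := mul_nonneg hR hv0
  have h2 : 0 ≤ ι * (b - a) := mul_nonneg hι (sub_nonneg.2 hab)
  obtain ⟨hv1, hv2⟩ := abs_le.1 hv
  rcases eq_or_ne B 0 with rfl | hB0
  · rw [mul_zero, sub_zero, abs_of_nonneg (mul_nonneg ha hA)]
    rcases eq_or_ne A 0 with rfl | hA0
    · rw [mul_zero]
      positivity
    · have h3 := mul_le_mul (hAR hA0) (by linarith : A ≤ v) hA hR
      linarith
  · have hbR := hBR hB0
    have h3 := mul_le_mul_of_nonneg_right hbR hv0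
    have h4 := mul_nonneg (sub_nonneg.2 hab) (by linarith : 0 ≤ ι + v / 2 - (A + B) / 2)
    have h5 := mul_nonneg (sub_nonneg.2 hab) (by linarith : 0 ≤ A + B)
    have h6 := mul_nonneg (add_nonneg ha hb) (by linarith : 0 ≤ v - (B - A))
    have h7 := mul_nonneg (add_nonneg ha hb) (by linarith : 0 ≤ v - (A - B))
    have h8 := mul_nonneg (sub_nonneg.2 hab) hv0
    rw [abs_le]
    constructor <;> nlinarith

theorem edist_sq_mul_le {F : ℝ → ℝ} {R x y : ℝ} (hR : 0 < R) (hF : ∀ x, 0 ≤ F x)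
    (h1 : ∀ x, F x ≠ 0 → |x| ≤ 1) (hx : F x ≠ 0 → x ^ 2 ≤ R) (hy : F y ≠ 0 → y ^ 2 ≤ R)
    (hxy : x ≤ y) :
    edist (x ^ 2 * F x) (y ^ 2 * F y) ≤ ENNReal.ofReal R * eVariationOn F (Icc x y) +
      2 * ∫⁻ z in Ioc x y, ENNReal.ofReal (F z) := by
  rcases eq_or_ne (eVariationOn F (Icc x y)) ⊤ with hv | hv
  · rw [hv, ENNReal.mul_top (ENNReal.ofReal_pos.2 hR).ne', top_add]
    exact le_top
  set v := (eVariationOn F (Icc x y)).toReal with hvdef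
  have hv0 : 0 ≤ v := ENNReal.toReal_nonneg
  have hdist : ∀ z ∈ Icc x y, |F x - F z| + |F z - F y| ≤ v := by
    intro z hz
    have h := eVariationOn.Icc_add_Icc F hz.1 hz.2 (mem_univ z)
    simp only [univ_inter] at h
    have hle := eVariationOn.mono F (Icc_subset_Icc_right hz.2 : Icc x z ⊆ Icc x y)
    have hle' := eVariationOn.mono F (Icc_subset_Icc_left hz.1 : Icc z y ⊆ Icc x y)
    have e1 : ENNReal.ofReal |F x - F z| ≤ eVariationOn F (Icc x z) := by
      rw [← Real.dist_eq, ← edist_dist]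
      exact eVariationOn.edist_le F (left_mem_Icc.2 hz.1) (right_mem_Icc.2 hz.1)
    have e2 : ENNReal.ofReal |F z - F y| ≤ eVariationOn F (Icc z y) := by
      rw [← Real.dist_eq, ← edist_dist]
      exact eVariationOn.edist_le F (left_mem_Icc.2 hz.2) (right_mem_Icc.2 hz.2)
    rw [hvdef, ← ENNReal.ofReal_le_iff_le_toReal hv, ENNReal.ofReal_add (abs_nonneg _)
      (abs_nonneg _), ← h]
    exact add_le_add e1 e2
  set ι := max 0 ((F x + F y - v) / 2) with hι
  have hιF : ∀ z ∈ Icc x y, ι ≤ F z := by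
    intro z hz
    refine max_le (hF z) ?_
    have := hdist z hz
    linarith [le_abs_self (F x - F z), neg_abs_le (F z - F y)]
  have hι0 : 0 ≤ ι := le_max_left _ _
  have hmain := abs_mul_sub_mul_le (hF x) (hF y) (sq_nonneg x) (sq_nonneg y) hR.le hx hy
    (by have := hdist x (left_mem_Icc.2 hxy); simpa using this) hι0 (le_max_right _ _)
  have hFint : ENNReal.ofReal (ι * |x ^ 2 - y ^ 2|) ≤
      2 * ∫⁻ z in Ioc x y, ENNReal.ofReal (F z) := by
    rcases hι0.eq_or_lt with h0 | h0
    · rw [← h0, zero_mul, ENNReal.ofReal_zero]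
      exact zero_le
    have hb : ∀ z ∈ Icc x y, |z| ≤ 1 := fun z hz => h1 z (h0.trans_le (hιF z hz)).ne'
    have hbx := abs_le.1 (hb x (left_mem_Icc.2 hxy))
    have hby := abs_le.1 (hb y (right_mem_Icc.2 hxy))
    have hsq : |x ^ 2 - y ^ 2| ≤ 2 * (y - x) := by
      rw [abs_le]
      constructor <;> nlinarith
    have hle : ENNReal.ofReal ι * volume (Ioc x y) ≤ ∫⁻ z in Ioc x y, ENNReal.ofReal (F z) := by
      rw [← setLIntegral_const]
      exact setLIntegral_mono' measurableSet_Ioc fun z hz =>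
        ENNReal.ofReal_le_ofReal (hιF z (Ioc_subset_Icc_self hz))
    refine le_trans ?_ (mul_le_mul' le_rfl hle)
    rw [Real.volume_Ioc, ← ENNReal.ofReal_mul hι0, ← ENNReal.ofReal_ofNat,
      ← ENNReal.ofReal_mul (by norm_num)]
    exact ENNReal.ofReal_le_ofReal (by nlinarith)
  rw [edist_dist, Real.dist_eq]
  refine (ENNReal.ofReal_le_ofReal hmain).trans ?_
  rw [ENNReal.ofReal_add (by positivity) (by positivity), ENNReal.ofReal_mul hR.le, hvdef,
    ENNReal.ofReal_toReal hv]
  exact add_le_add le_rfl hFint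

theorem eVariationOn_sq_mul_le {F : ℝ → ℝ} {s : Set ℝ} (hs : s.OrdConnected) {R : ℝ} (hR : 0 < R)
    (hF : ∀ x, 0 ≤ F x) (h1 : ∀ x, F x ≠ 0 → |x| ≤ 1) (hsR : ∀ x ∈ s, F x ≠ 0 → x ^ 2 ≤ R) :
    eVariationOn (fun x => x ^ 2 * F x) s ≤
      ENNReal.ofReal R * eVariationOn F s + 2 * ∫⁻ x, ENNReal.ofReal (F x) := by
  refine iSup_le fun ⟨n, u, hu, us⟩ => ?_
  have h : ∀ i ∈ Finset.range n,
      edist (u (i + 1) ^ 2 * F (u (i + 1))) (u i ^ 2 * F (u i)) ≤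
      ENNReal.ofReal R * eVariationOn F (Icc (u i) (u (i + 1))) +
        2 * ∫⁻ z in Ioc (u i) (u (i + 1)), ENNReal.ofReal (F z) := fun i _ => by
    rw [edist_comm]
    exact edist_sq_mul_le hR hF h1 (hsR _ (us i)) (hsR _ (us (i + 1))) (hu i.le_succ)
  refine (Finset.sum_le_sum h).trans ?_
  rw [Finset.sum_add_distrib, ← Finset.mul_sum, ← Finset.mul_sum, eVariationOn.sum' F hu]
  refine add_le_add (mul_le_mul' le_rfl (eVariationOn.mono F (hs.out (us 0) (us n))))
    (mul_le_mul' le_rfl ?_)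
  rw [← lintegral_biUnion_finset (fun i _ j _ hij => ?_) (fun i _ => measurableSet_Ioc)]
  · exact setLIntegral_le_lintegral _ _
  · exact hu.pairwise_disjoint_on_Ioc_succ hij

end Variation

section LasotaYorke
open scoped ENNReal

theorem eVariationOn_indicator_Ici_le {F : ℝ → ℝ} (hF : ∀ x, 0 ≤ F x) {a α : ℝ} (ha : a ≤ 0)
    (hα : 0 ≤ α) :
    eVariationOn ((Ico a α).indicator F) (Ici 0) ≤
      eVariationOn F (Icc 0 α) + ENNReal.ofReal (F α) := by
  have hmono : Monotone fun x : ℝ => if α ≤ x then F α else 0 := by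
    intro x y hxy
    have := hF α
    simp only
    split_ifs <;> linarith
  have hJ := hmono.eVariationOn_le_ofReal (A := F α)
    (fun x => by have := hF α; split_ifs <;> linarith)
    (fun x => by have := hF α; split_ifs <;> linarith) (Ici 0)
  have hc := eVariationOn.comp_le_of_monotoneOn F (s := Icc 0 α) (t := Ici 0) (fun x => min x α)
    (fun x _ y _ h => min_le_min_right _ h) (fun x hx => ⟨le_min hx hα, min_le_right _ _⟩)
  refine (eVariationOn_le_add fun x hx y hy => ?_).trans (add_le_add hc hJ)
  have key : ∀ x ∈ Ici (0 : ℝ), (Ico a α).indicator F x =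
      F (min x α) - if α ≤ x then F α else 0 := by
    intro x hx
    rcases le_or_gt α x with h | h
    · rw [indicator_of_notMem fun h' => h'.2.not_ge h, if_pos h, min_eq_right h, sub_self]
    · rw [indicator_of_mem (show x ∈ Ico a α from ⟨ha.trans hx, h⟩), if_neg h.not_ge, min_eq_left h.le, sub_zero]
  rw [key x hx, key y hy, edist_dist, edist_dist, edist_dist, ← ENNReal.ofReal_add dist_nonneg
    dist_nonneg]
  exact ENNReal.ofReal_le_ofReal (dist_sub_sub_le _ _ _ _)

theorem eVariationOn_indicator_Iic_le {F : ℝ → ℝ} (hF : ∀ x, 0 ≤ F x) {a α : ℝ} (ha : a ≤ 0)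
    (hα : 0 < α) :
    eVariationOn ((Ico a α).indicator F) (Iic 0) ≤
      eVariationOn F (Icc a 0) + ENNReal.ofReal (F a) := by
  have hmono : Monotone fun x : ℝ => if a ≤ x then F a else 0 := by
    intro x y hxy
    have := hF a
    simp only
    split_ifs <;> linarith
  have hJ := hmono.eVariationOn_le_ofReal (A := F a)
    (fun x => by have := hF a; split_ifs <;> linarith)
    (fun x => by have := hF a; split_ifs <;> linarith) (Iic 0)
  have hc := eVariationOn.comp_le_of_monotoneOn F (s := Icc a 0) (t := Iic 0) (fun x => max x a)
    (fun x _ y _ h => max_le_max_right _ h) (fun x hx => ⟨le_max_right _ _, max_le hx ha⟩)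
  refine (eVariationOn_le_add fun x hx y hy => ?_).trans (add_le_add hc hJ)
  have key : ∀ x ∈ Iic (0 : ℝ), (Ico a α).indicator F x =
      F (max x a) + (if a ≤ x then F a else 0) - F a := by
    intro x hx
    rcases le_or_gt a x with h | h
    · rw [indicator_of_mem (show x ∈ Ico a α from ⟨h, lt_of_le_of_lt hx hα⟩), if_pos h, max_eq_left h, add_sub_cancel_right]
    · rw [indicator_of_notMem fun h' => h'.1.not_gt h, if_neg h.not_ge, max_eq_right h.le]
      ring
  rw [key x hx, key y hy, edist_sub_right, edist_dist, edist_dist, edist_dist,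
    ← ENNReal.ofReal_add dist_nonneg dist_nonneg]
  exact ENNReal.ofReal_le_ofReal (dist_add_add_le _ _ _ _)

theorem eVariationOn_comp_inv_le {H : ℝ → ℝ} (hH : ∀ x, x = 0 ∨ 1 ≤ |x| → H x = 0) :
    eVariationOn (fun w => H w⁻¹) univ ≤ eVariationOn H (Ici 0) + eVariationOn H (Iic 0) := by
  have hzero : ∀ w ∈ Icc (-1 : ℝ) 1, H w⁻¹ = 0 := by
    intro w hw
    rcases eq_or_ne w 0 with rfl | h0
    · exact hH _ (Or.inl inv_zero)
    · refine hH _ (Or.inr ?_)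
      rw [abs_inv]
      exact (one_le_inv₀ (abs_pos.2 h0)).2 (abs_le.2 hw)
  have h1 : eVariationOn (fun w => H w⁻¹) (Icc (-1) 1) = 0 := by
    refine eVariationOn.constant_on ?_
    rintro _ ⟨x, hx, rfl⟩ _ ⟨y, hy, rfl⟩
    simp only [hzero x hx, hzero y hy]
  have h2 : eVariationOn (fun w => H w⁻¹) (Ici 1) ≤ eVariationOn H (Ici 0) :=
    eVariationOn.comp_le_of_antitoneOn H (fun w => w⁻¹)
      (fun x hx y _ h => inv_anti₀ (zero_lt_one.trans_le hx) h)
      fun x hx => mem_Ici.2 (inv_nonneg.2 (zero_le_one.trans hx))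
  have h3 : eVariationOn (fun w => H w⁻¹) (Iic (-1)) ≤ eVariationOn H (Iic 0) := by
    refine eVariationOn.comp_le_of_antitoneOn H (fun w => w⁻¹) (fun x hx y hy h => ?_) fun x hx => ?_
    · have hx' : x < 0 := by linarith [mem_Iic.1 hx]
      have hy' : y < 0 := by linarith [mem_Iic.1 hy]
      exact (inv_le_inv_of_neg hy' hx').2 h
    · have hx' : x ≤ 0 := by linarith [mem_Iic.1 hx]
      exact mem_Iic.2 (inv_nonpos.2 hx')
  have hu : (univ : Set ℝ) = (Iic (-1) ∪ Icc (-1) 1) ∪ Ici 1 := by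
    rw [Iic_union_Icc_eq_Iic (by norm_num), Iic_union_Ici]
  rw [hu, eVariationOn.union _ (x := 1), eVariationOn.union _ (x := -1), h1, add_zero, add_comm]
  · exact add_le_add h2 h3
  · exact isGreatest_Iic
  · exact isLeast_Icc (by norm_num)
  · rw [Iic_union_Icc_eq_Iic (by norm_num)]
    exact isGreatest_Iic
  · exact isLeast_Ici

theorem transferOp_eq_tsum_ofReal (α : ℝ) {f : ℝ → ℝ≥0∞} (hf : ∀ x, f x ≠ ⊤) (y : ℝ) :
    transferOp α f y = ∑' a : ℤ, ENNReal.ofReal ((y + a)⁻¹ ^ 2 *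
      (Ico (α - 1) α).indicator (fun x => (f x).toReal) (y + a)⁻¹) := by
  refine tsum_congr fun a => ?_
  rw [ENNReal.ofReal_mul (by positivity), inv_pow]
  congr 1
  by_cases h : (y + a)⁻¹ ∈ Ico (α - 1) α
  · rw [indicator_of_mem h, indicator_of_mem h, ENNReal.ofReal_toReal (hf _)]
  · rw [indicator_of_notMem h, indicator_of_notMem h, ENNReal.ofReal_zero]

theorem eVariationOn_transferOp_le {α : ℝ} (hα : 0 < α) (hα' : α < 1) {f : ℝ → ℝ≥0∞}
    (hf : ∀ x, f x ≠ ⊤) (hPf : ∀ x, transferOp α f x ≠ ⊤) {F : ℝ → ℝ}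
    (hF : F = (Ico (α - 1) α).indicator fun x => (f x).toReal) :
    eVariationOn (fun x => (transferOp α f x).toReal) (Icc (α - 1) α) ≤
      eVariationOn (fun x => x ^ 2 * F x) (Ici 0) +
      eVariationOn (fun x => x ^ 2 * F x) (Iic 0) := by
  simp only [transferOp_eq_tsum_ofReal α hf, ← hF] at hPf ⊢
  refine (eVariationOn_tsum_le _ fun x _ => hPf x).trans ?_
  refine le_trans (ENNReal.tsum_le_tsum fun a => ?_) ((tsum_eVariationOn_Icc_int_le
    (fun w => w⁻¹ ^ 2 * F w⁻¹) (α - 1)).trans (eVariationOn_comp_inv_le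
    (H := fun x => x ^ 2 * F x) fun x hx => ?_))
  · refine eVariationOn.comp_le_of_monotoneOn (fun w => w⁻¹ ^ 2 * F w⁻¹) (fun y => y + (a : ℝ))
      (fun x _ y _ h => add_le_add_left h _) fun x hx => ⟨?_, ?_⟩
    · linarith [hx.1]
    · linarith [hx.2]
  · rcases hx with rfl | hx
    · simp
    · have : x ∉ Ico (α - 1) α := by
        intro h
        have : |x| < 1 := abs_lt.2 ⟨by linarith [h.1], h.2.trans hα'⟩
        linarith
      simp only [hF, indicator_of_notMem this, mul_zero]

/-- A `1`-periodic finite probability density on `[α - 1, α)` of variation at most `V`. -/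
structure IsBVDensity (α : ℝ) (V : ℝ≥0∞) (f : ℝ → ℝ≥0∞) : Prop where
  measurable : Measurable f
  periodic : Function.Periodic f 1
  ne_top : ∀ x, f x ≠ ⊤
  lintegral_eq : ∫⁻ x in Ico (α - 1) α, f x = 1
  eVariationOn_le : eVariationOn (fun x => (f x).toReal) (Icc (α - 1) α) ≤ V

namespace IsBVDensity

variable {α : ℝ} {V : ℝ≥0∞} {f : ℝ → ℝ≥0∞}

theorem exists_le (hf : IsBVDensity α V f) {a b : ℝ} (ha : α - 1 ≤ a) (hab : a < b) (hb : b ≤ α) :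
    ∃ x ∈ Ioo a b, f x ≤ ENNReal.ofReal (b - a)⁻¹ := by
  have hvol : volume (Ioo a b) = ENNReal.ofReal (b - a) := Real.volume_Ioo
  obtain ⟨x, hx, hfx⟩ := exists_le_setLAverage (μ := volume) (s := Ioo a b) (f := f)
    (by rw [hvol]; exact (ENNReal.ofReal_pos.2 (sub_pos.2 hab)).ne') (by simp [hvol])
    hf.measurable.aemeasurable
  refine ⟨x, hx, hfx.trans ?_⟩
  rw [setLAverage_eq, hvol, ENNReal.ofReal_inv_of_pos (sub_pos.2 hab), ← one_div]
  refine ENNReal.div_le_div_right ?_ _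
  rw [← hf.lintegral_eq]
  exact lintegral_mono_set fun x hx => ⟨ha.trans hx.1.le, hx.2.trans_le hb⟩

theorem le_add_eVariationOn (hf : IsBVDensity α V f) {a b : ℝ} (ha : α - 1 ≤ a) (hab : a < b)
    (hb : b ≤ α) {x : ℝ} (hx : x ∈ Icc a b) :
    f x ≤ ENNReal.ofReal (b - a)⁻¹ + eVariationOn (fun x => (f x).toReal) (Icc a b) := by
  obtain ⟨p, hp, hfp⟩ := hf.exists_le ha hab hb
  have := ofReal_le_ofReal_add_edist (f x).toReal (f p).toReal
  rw [ENNReal.ofReal_toReal (hf.ne_top x), ENNReal.ofReal_toReal (hf.ne_top p)] at this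
  exact this.trans (add_le_add hfp
    (eVariationOn.edist_le (fun x => (f x).toReal) hx (Ioo_subset_Icc_self hp)))

theorem le_one_add (hf : IsBVDensity α V f) (x : ℝ) : f x ≤ 1 + V := by
  obtain ⟨m, hm, -⟩ := existsUnique_add_zsmul_mem_Ico one_pos x (α - 1)
  rw [sub_add_cancel] at hm
  rw [← hf.periodic.zsmul m x]
  refine (hf.le_add_eVariationOn le_rfl (by linarith) le_rfl (Ico_subset_Icc_self hm)).trans ?_
  refine add_le_add ?_ hf.eVariationOn_le
  simp

theorem transferOp_ne_top (hf : IsBVDensity α V f) (hV : V ≠ ⊤) (y : ℝ) : transferOp α f y ≠ ⊤ := by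
  have hs : Summable fun a : ℤ => ((y + a) ^ 2)⁻¹ := by
    have := (Real.summable_one_div_int_add_rpow y 2).2 (by norm_num)
    refine this.congr fun a => ?_
    rw [Real.rpow_ofNat, sq_abs, one_div, add_comm]
  have h1 : ∑' a : ℤ, ENNReal.ofReal (((y + a) ^ 2)⁻¹) ≠ ⊤ := hs.tsum_ofReal_ne_top
  refine ne_top_of_le_ne_top (ENNReal.mul_ne_top h1 (by simp [hV] : 1 + V ≠ ⊤)) ?_
  rw [← ENNReal.tsum_mul_right]
  refine ENNReal.tsum_le_tsum fun a => mul_le_mul' le_rfl ?_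
  exact indicator_le' (fun x _ => hf.le_one_add x) (fun _ _ => zero_le) _

theorem eVariationOn_transferOp (hf : IsBVDensity α V f) (hα : 0 < α) (hα' : α < 1) (hV : V ≠ ⊤) :
    eVariationOn (fun x => (transferOp α f x).toReal) (Icc (α - 1) α) ≤
      ENNReal.ofReal (α ^ 2 + (1 - α) ^ 2) * V +
        (ENNReal.ofReal (α⁻¹ + (1 - α)⁻¹) + 4) := by
  set F : ℝ → ℝ := fun x => (f x).toReal with hF
  set F₁ := (Ico (α - 1) α).indicator F with hF₁
  have hF0 : ∀ x, 0 ≤ F x := fun x => ENNReal.toReal_nonneg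
  have hF₁0 : ∀ x, 0 ≤ F₁ x := fun x => indicator_nonneg (fun x _ => hF0 x) x
  have hmem : ∀ x, F₁ x ≠ 0 → x ∈ Ico (α - 1) α := fun x hx => by
    by_contra h
    exact hx (indicator_of_notMem h _)
  have habs : ∀ x, F₁ x ≠ 0 → |x| ≤ 1 := fun x hx => by
    have := hmem x hx
    exact abs_le.2 ⟨by linarith [this.1], by linarith [this.2]⟩
  have hFint : ∫⁻ x, ENNReal.ofReal (F₁ x) = 1 := by
    rw [← hf.lintegral_eq, ← lintegral_indicator measurableSet_Ico]
    refine lintegral_congr fun x => ?_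
    by_cases h : x ∈ Ico (α - 1) α
    · rw [hF₁, indicator_of_mem h, indicator_of_mem h, ENNReal.ofReal_toReal (hf.ne_top x)]
    · rw [hF₁, indicator_of_notMem h, indicator_of_notMem h, ENNReal.ofReal_zero]
  have hpos := eVariationOn_sq_mul_le (F := F₁) ordConnected_Ici (R := α ^ 2) (by positivity) hF₁0
    habs (s := Ici 0) fun x hx h => by
      have := (hmem x h).2
      have := mem_Ici.1 hx
      nlinarith
  have hneg := eVariationOn_sq_mul_le (F := F₁) ordConnected_Iic (R := (1 - α) ^ 2)
    (by have := sub_pos.2 hα'; positivity) hF₁0 habs (s := Iic 0) fun x hx h => by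
      have := (hmem x h).1
      have := mem_Iic.1 hx
      nlinarith
  rw [hFint, mul_one] at hpos hneg
  have hJpos := eVariationOn_indicator_Ici_le hF0 (a := α - 1) (by linarith) hα.le
  have hJneg := eVariationOn_indicator_Iic_le hF0 (a := α - 1) (by linarith) hα
  have hA : F (α - 1) = F α := by
    have := hf.periodic (α - 1)
    rw [sub_add_cancel] at this
    simp only [hF, this]
  rw [hA] at hJneg
  have hsum : eVariationOn F (Icc (α - 1) 0) + eVariationOn F (Icc 0 α) ≤ V := by
    have := eVariationOn.Icc_add_Icc F (by linarith : α - 1 ≤ 0) hα.le (mem_univ 0)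
    simp only [univ_inter] at this
    exact this.le.trans hf.eVariationOn_le
  have hAle₁ := hf.le_add_eVariationOn (by linarith) hα le_rfl (right_mem_Icc.2 hα.le)
  have hAle₂ := hf.le_add_eVariationOn le_rfl (by linarith : α - 1 < 0) hα.le
    (left_mem_Icc.2 (by linarith))
  rw [← ENNReal.ofReal_toReal (hf.ne_top _)] at hAle₁ hAle₂
  change ENNReal.ofReal (F α) ≤ _ + eVariationOn F _ at hAle₁
  change ENNReal.ofReal (F (α - 1)) ≤ _ + eVariationOn F _ at hAle₂
  rw [hA, zero_sub, neg_sub] at hAle₂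
  rw [sub_zero] at hAle₁
  refine (eVariationOn_transferOp_le hα hα' hf.ne_top (hf.transferOp_ne_top hV) hF₁).trans ?_
  refine (add_le_add hpos hneg).trans ?_
  generalize eVariationOn F (Icc (α - 1) 0) = V₁ at *
  generalize eVariationOn F (Icc 0 α) = V₂ at *
  generalize ENNReal.ofReal (F α) = A at *
  have h1 : 0 < α⁻¹ := inv_pos.2 hα
  have h2 : 0 < (1 - α)⁻¹ := inv_pos.2 (sub_pos.2 hα')
  have hpos' := hJpos.trans (show V₂ + A ≤ V + ENNReal.ofReal (α⁻¹ + (1 - α)⁻¹) from by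
    refine (add_le_add le_rfl hAle₂).trans ?_
    rw [add_left_comm, add_comm, add_comm V₂]
    exact add_le_add hsum (ENNReal.ofReal_le_ofReal (by linarith)))
  have hneg' := hJneg.trans (show V₁ + A ≤ V + ENNReal.ofReal (α⁻¹ + (1 - α)⁻¹) from by
    refine (add_le_add le_rfl hAle₁).trans ?_
    rw [add_left_comm, add_comm]
    exact add_le_add hsum (ENNReal.ofReal_le_ofReal (by linarith)))
  refine (add_le_add (add_le_add (mul_le_mul' le_rfl hpos') le_rfl)
    (add_le_add (mul_le_mul' le_rfl hneg') le_rfl)).trans ?_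
  have hθ : ENNReal.ofReal (α ^ 2 + (1 - α) ^ 2) ≤ 1 :=
    ENNReal.ofReal_le_one.2 (by nlinarith)
  generalize ENNReal.ofReal (α⁻¹ + (1 - α)⁻¹) = c at *
  calc _ = ENNReal.ofReal (α ^ 2 + (1 - α) ^ 2) * V +
        (ENNReal.ofReal (α ^ 2 + (1 - α) ^ 2) * c + 4) := by
        rw [ENNReal.ofReal_add (sq_nonneg _) (sq_nonneg _)]
        ring
    _ ≤ _ := add_le_add le_rfl (add_le_add (mul_le_of_le_one_left' hθ) le_rfl)

theorem transferOp (hf : IsBVDensity α V f) (hα : 0 < α) (hα' : α < 1) (hV : V ≠ ⊤)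
    (hV' : ENNReal.ofReal (α ^ 2 + (1 - α) ^ 2) * V +
      (ENNReal.ofReal (α⁻¹ + (1 - α)⁻¹) + 4) ≤ V) :
    IsBVDensity α V (transferOp α f) where
  measurable := measurable_transferOp hf.measurable
  periodic := transferOp_periodic α f
  ne_top := hf.transferOp_ne_top hV
  lintegral_eq := by
    rw [lintegral_transferOp hf.measurable measurableSet_Ico le_rfl,
      (eq_univ_of_forall (T_mem hα hα'.le) : T α ⁻¹' Ico (α - 1) α = univ), univ_inter,
      hf.lintegral_eq]
  eVariationOn_le := (hf.eVariationOn_transferOp hα hα' hV).trans hV'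

end IsBVDensity

theorem exists_isBVDensity_transferOp_iterate {α : ℝ} (hα : 0 < α) (hα' : α < 1) :
    ∃ V : ℝ, 0 ≤ V ∧
      ∀ n, IsBVDensity α (ENNReal.ofReal V) ((transferOp α)^[n] fun _ => 1) := by
  have hθ : 0 < 1 - (α ^ 2 + (1 - α) ^ 2) := by nlinarith
  have h1 : 0 < α⁻¹ := inv_pos.2 hα
  have h2 : 0 < (1 - α)⁻¹ := inv_pos.2 (sub_pos.2 hα')
  set V := (α⁻¹ + (1 - α)⁻¹ + 4) / (1 - (α ^ 2 + (1 - α) ^ 2)) with hV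
  have hV0 : 0 ≤ V := by positivity
  refine ⟨V, hV0, fun n => ?_⟩
  induction n with
  | zero =>
    exact ⟨measurable_const, fun _ => rfl, fun _ => ENNReal.one_ne_top, by simp, by
      rw [eVariationOn.constant_on]
      · exact zero_le
      · rintro _ ⟨x, -, rfl⟩ _ ⟨y, -, rfl⟩
        rfl⟩
  | succ n ih =>
    rw [Function.iterate_succ_apply']
    refine ih.transferOp hα hα' ENNReal.ofReal_ne_top ?_
    rw [← ENNReal.ofReal_ofNat 4, ← ENNReal.ofReal_mul (by positivity),
      ← ENNReal.ofReal_add (by positivity) (by positivity),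
      ← ENNReal.ofReal_add (by positivity) (by positivity)]
    refine ENNReal.ofReal_le_ofReal (le_of_eq ?_)
    rw [hV]
    field_simp
    ring

end LasotaYorke

section TwoSidedBound
open scoped ENNReal

theorem IsBVDensity.exists_half_le {α V : ℝ} {f : ℝ → ℝ≥0∞}
    (hf : IsBVDensity α (ENNReal.ofReal V) f) (hV : 0 ≤ V) {M : ℕ} (hM : 2 * V < M) :
    ∃ j ∈ Finset.range M, ∀ x ∈ Ioo (α - 1 + j / M) (α - 1 + (j + 1 : ℕ) / M),
      ENNReal.ofReal (1 / 2) ≤ f x := by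
  by_contra! hcon
  have hM0 : (0 : ℝ) < M := by linarith
  set E : ℕ → ℝ := fun j => α - 1 + j / M with hE
  have hEmono : Monotone E := fun i j h => by
    have : (i : ℝ) ≤ j := by exact_mod_cast h
    simp only [hE]
    gcongr
  have hstep : ∀ j, E (j + 1) - E j = 1 / M := fun j => by
    simp only [hE]
    push_cast
    ring
  have hE0 : E 0 = α - 1 := by simp [hE]
  have hEM : E M = α := by
    simp only [hE]
    rw [div_self hM0.ne']
    ring
  have hle : ∀ j ∈ Finset.range M, ∫⁻ x in Ioc (E j) (E (j + 1)), f x ≤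
      (ENNReal.ofReal (1 / 2) + eVariationOn (fun x => (f x).toReal) (Icc (E j) (E (j + 1)))) *
        ENNReal.ofReal (1 / M) := by
    intro j hj
    obtain ⟨p, hp, hfp⟩ := hcon j hj
    rw [← hstep j, ← Real.volume_Ioc, ← setLIntegral_const]
    refine setLIntegral_mono' measurableSet_Ioc fun x hx => ?_
    have := ofReal_le_ofReal_add_edist (f x).toReal (f p).toReal
    rw [ENNReal.ofReal_toReal (hf.ne_top x), ENNReal.ofReal_toReal (hf.ne_top p)] at this
    exact this.trans (add_le_add hfp.le (eVariationOn.edist_le (fun x => (f x).toReal)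
      (Ioc_subset_Icc_self hx) (Ioo_subset_Icc_self hp)))
  have hunion : Ioc (α - 1) α = ⋃ j ∈ Finset.range M, Ioc (E j) (E (j + 1)) := by
    rw [← hE0, ← hEM, ← hEmono.biUnion_Ico_Ioc_map_succ 0 M]
    simp
  have hone := hf.lintegral_eq
  rw [setLIntegral_congr Ico_ae_eq_Ioc, hunion,
    lintegral_biUnion_finset (t := fun j => Ioc (E j) (E (j + 1)))
      (fun i _ j _ hij => hEmono.pairwise_disjoint_on_Ioc_succ hij)
      (fun i _ => measurableSet_Ioc)] at hone
  have hlt : (1 : ℝ≥0∞) ≤ ENNReal.ofReal ((M * (1 / 2) + V) * (1 / M)) := by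
    rw [← hone]
    refine (Finset.sum_le_sum hle).trans ?_
    rw [← Finset.sum_mul, Finset.sum_add_distrib, eVariationOn.sum' _ hEmono, hE0, hEM,
      ENNReal.ofReal_mul (by positivity), ENNReal.ofReal_add (by positivity) hV,
      ENNReal.ofReal_mul hM0.le, Finset.sum_const, Finset.card_range, nsmul_eq_mul,
      ENNReal.ofReal_natCast]
    exact mul_le_mul' (add_le_add le_rfl hf.eVariationOn_le) le_rfl
  rw [ENNReal.one_le_ofReal, mul_one_div, le_div_iff₀ hM0] at hlt
  linarith

theorem exists_le_transferOp_one {α : ℝ} (hα : 0 < α) (hα' : α ≤ 1) :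
    ∃ c : ℝ≥0∞, c ≠ 0 ∧ ∀ y, c ≤ transferOp α (fun _ => 1) y := by
  have h1 : 0 < α⁻¹ := inv_pos.2 hα
  refine ⟨ENNReal.ofReal ((α⁻¹ + 1) ^ 2)⁻¹, (ENNReal.ofReal_pos.2 (by positivity)).ne',
    fun y => ?_⟩
  obtain ⟨m, hm, -⟩ := existsUnique_add_zsmul_mem_Ioc one_pos y α⁻¹
  rw [← (transferOp_periodic α _).zsmul m y]
  generalize y + m • (1 : ℝ) = w at hm
  have hw : 0 < w := h1.trans hm.1
  have hwi : 0 < w⁻¹ := inv_pos.2 hw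
  refine le_trans ?_ (le_transferOp ⟨by linarith, inv_lt_of_inv_lt₀ hα hm.1⟩)
  rw [mul_one]
  exact ENNReal.ofReal_le_ofReal (inv_anti₀ (by positivity) (pow_le_pow_left₀ hw.le hm.2 2))

theorem transferOp_iterate_const_mul (α : ℝ) (c : ℝ≥0∞) (n : ℕ) (f : ℝ → ℝ≥0∞) :
    (transferOp α)^[n] (fun x => c * f x) = fun x => c * (transferOp α)^[n] f x := by
  induction n generalizing f with
  | zero => rfl
  | succ n ih => rw [Function.iterate_succ_apply, transferOp_const_mul, ih,
      Function.iterate_succ_apply]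

theorem const_mul_le_transferOp_iterate {α : ℝ} {f : ℝ → ℝ≥0∞} {b : ℝ≥0∞} (hf : ∀ x, b ≤ f x)
    (n : ℕ) (y : ℝ) :
    b * (transferOp α)^[n] (fun _ => 1) y ≤ (transferOp α)^[n] f y := by
  rw [← congrFun (transferOp_iterate_const_mul α b n fun _ => 1) y]
  exact (transferOp_monotone α).iterate n (fun x => by simpa using hf x) y

theorem exists_pow_le_transferOp_iterate_one {α : ℝ} (hα : 0 < α) (hα' : α ≤ 1) :
    ∃ c : ℝ≥0∞, c ≠ 0 ∧ ∀ n y, c ^ n ≤ (transferOp α)^[n] (fun _ => 1) y := by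
  obtain ⟨c, hc, h⟩ := exists_le_transferOp_one hα hα'
  refine ⟨c, hc, fun n => ?_⟩
  induction n with
  | zero => simp
  | succ n ih =>
    intro y
    rw [pow_succ', Function.iterate_succ_apply]
    exact (mul_le_mul' le_rfl (ih y)).trans (const_mul_le_transferOp_iterate h n y)

theorem exists_transferOp_iterate_one_mem_Icc {α : ℝ} (hα : 0 < α) (hα' : α < 1) :
    ∃ c C : ℝ, 0 < c ∧ ∀ n y,
      (transferOp α)^[n] (fun _ => 1) y ∈ Icc (ENNReal.ofReal c) (ENNReal.ofReal C) := by
  obtain ⟨V, hV, hBV⟩ := exists_isBVDensity_transferOp_iterate hα hα'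
  obtain ⟨M, hM⟩ := exists_nat_gt (2 * V)
  obtain ⟨c₁, hc₁, hpow⟩ := exists_pow_le_transferOp_iterate_one hα hα'.le
  have hspread : ∀ j : ℕ, Spreads α (α - 1 + j / M) (α - 1 + (j + 1 : ℕ) / M) := fun j => by
    have : (0 : ℝ) < M := by linarith
    refine spreads_of_lt hα hα' ?_
    gcongr
    simp
  choose k c hc hkc using hspread
  set K := (Finset.range M).sup k with hK
  set d := ((Finset.range M).inf fun j => c j * ENNReal.ofReal (1 / 2) * c₁ ^ (K - k j)) ⊓
    (Finset.range K).inf fun n => c₁ ^ n with hd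
  have hd0 : 0 < d := by
    refine lt_min ?_ ?_
    · refine (Finset.lt_inf_iff ENNReal.zero_lt_top).2 fun j _ => pos_iff_ne_zero.2 ?_
      exact mul_ne_zero (mul_ne_zero (hc j) (ENNReal.ofReal_pos.2 (by norm_num)).ne')
        (pow_ne_zero _ hc₁)
    · exact (Finset.lt_inf_iff ENNReal.zero_lt_top).2 fun j _ =>
        pos_iff_ne_zero.2 (pow_ne_zero _ hc₁)
  have hlow : ∀ n y, d ≤ (transferOp α)^[n] (fun _ => 1) y := by
    intro n y
    rcases lt_or_ge n K with hn | hn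
    · exact (inf_le_right.trans (Finset.inf_le (Finset.mem_range.2 hn))).trans (hpow n y)
    · obtain ⟨j, hj, hhalf⟩ := (hBV (n - K)).exists_half_le hV hM
      have hkj : k j ≤ K := Finset.le_sup hj
      have h1 := hkc j _ (hBV (n - K)).periodic _ hhalf
      have h2 := const_mul_le_transferOp_iterate (α := α) h1 (K - k j) y
      rw [← Function.iterate_add_apply, ← Function.iterate_add_apply,
        show K - k j + k j + (n - K) = n by omega] at h2
      have h3 : d ≤ c j * ENNReal.ofReal (1 / 2) * c₁ ^ (K - k j) :=
        inf_le_left.trans (Finset.inf_le (f := fun j => c j * ENNReal.ofReal (1 / 2) *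
          c₁ ^ (K - k j)) hj)
      exact (h3.trans (mul_le_mul' le_rfl (hpow _ y))).trans h2
  have hup : ∀ n y, (transferOp α)^[n] (fun _ => 1) y ≤ ENNReal.ofReal (1 + V) := by
    intro n y
    rw [ENNReal.ofReal_add zero_le_one hV, ENNReal.ofReal_one]
    exact (hBV n).le_one_add y
  have hdtop : d ≠ ⊤ := ne_top_of_le_ne_top ENNReal.ofReal_ne_top ((hlow 0 0).trans (hup 0 0))
  refine ⟨d.toReal, 1 + V, ENNReal.toReal_pos hd0.ne' hdtop, fun n y => ⟨?_, hup n y⟩⟩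
  rw [ENNReal.ofReal_toReal hdtop]
  exact hlow n y

end TwoSidedBound

/-- The density of μ_α w.r.t. Lebesgue measure is bounded above and away from zero:
there is C > 1 with C⁻¹ λ(A) ≤ μ_α(A) ≤ C λ(A) for all Borel A ⊆ [α−1, α). -/
theorem density_bounded (α : ℝ) (hα : α ∈ Set.Icc (1 / 2 : ℝ) 1)
    (μ : Measure ℝ) (hprob : IsProbabilityMeasure μ) (herg : Ergodic (T α) μ)
    (hac : μ ≪ volume.restrict (Set.Ico (α - 1) α))
    (hca : volume.restrict (Set.Ico (α - 1) α) ≪ μ) :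
    ∃ C : ENNReal, 1 < C ∧ C ≠ ⊤ ∧
      ∀ A : Set ℝ, MeasurableSet A → A ⊆ Set.Ico (α - 1) α →
        C⁻¹ * volume A ≤ μ A ∧ μ A ≤ C * volume A := by
  have hα0 : 0 < α := by linarith [hα.1]
  rcases hα.2.eq_or_lt with rfl | hα1
  · refine exists_bound_of_transferOp_iterate_bound hα0 le_rfl herg hca
      (by norm_num : (0 : ℝ) < 1 / 2) (C := 2) fun n y hy hy0 =>
        transferOp_one_iterate_mem_Icc n ⟨lt_of_le_of_ne ?_ hy0.symm, hy.2⟩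
    simpa using hy.1
  · obtain ⟨c, C, hc, h⟩ := exists_transferOp_iterate_one_mem_Icc hα0 hα1
    exact exists_bound_of_transferOp_iterate_bound hα0 hα1.le herg hca hc fun n y _ _ => h n y
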